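/- arXiv:2404.00688 — 2 statements merged into one kernel-verified Lean document; each statement's English description precedes it below -/
import Mathlib

section
/- Let P be a d×d real orthogonal projection matrix of rank p with 1 ≤ p ≤ d−1, P⊥ = I − P, q = d − p, 0 < λ₂ ≤ λ₁, δ ∈ (0,1), V > 0. Let D ∈ ℝ^{k×d} have rows of Euclidean norm at most 1, θ*, θ̄ ∈ ℝ^d with ‖θ*‖ ≤ V, ε ∈ ℝ^k, y = Dθ* + ε, B = DᵀD + λ₁·P⊥ + λ₂·P, θ̂ = B⁻¹(Dᵀy + λ₁·P⊥θ̄), and W = ‖P⊥(θ* − θ̄)‖. If the self-normalized noise bound ‖Dᵀε‖²_{B⁻¹} ≤ log( det(B) / (δ²·λ₁^q·λ₂^p) ) holds, then ‖θ̂ − θ*‖_B ≤ √( p·log(1 + k/(p·λ₂)) + q·log(1 + k/(q·λ₁)) + log(1/δ²) ) + √λ₂·V + (λ₁/√λ₂)·W. -/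
open Matrix

section ProjectionSpectrum

variable {n : Type*} [Fintype n] [DecidableEq n] {P : Matrix n n ℝ}

/-- The eigenvalues of a symmetric idempotent matrix are `0` or `1`. -/
lemma Matrix.IsHermitian.eigenvalues_eq_zero_or_one (hP : P.IsHermitian) (hidem : P * P = P)
    (i : n) : hP.eigenvalues i = 0 ∨ hP.eigenvalues i = 1 := by
  have h1 := hP.mulVec_eigenvectorBasis i
  have h2 : P *ᵥ (P *ᵥ ⇑(hP.eigenvectorBasis i)) = P *ᵥ ⇑(hP.eigenvectorBasis i) := by
    rw [mulVec_mulVec, hidem]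
  rw [h1, mulVec_smul, h1, smul_smul] at h2
  have hne : (⇑(hP.eigenvectorBasis i) : n → ℝ) ≠ 0 := by
    intro h
    refine hP.eigenvectorBasis.orthonormal.ne_zero i ?_
    ext j
    exact congrFun h j
  have h3 := smul_left_injective ℝ hne h2
  rcases eq_or_ne (hP.eigenvalues i) 0 with h | h
  · exact Or.inl h
  · exact Or.inr (mul_left_cancel₀ h (by simpa using h3))

/-- The trace of an orthogonal projection is its rank. -/
lemma Matrix.IsHermitian.trace_eq_rank_of_idem (hP : P.IsHermitian) (hidem : P * P = P) :
    P.trace = P.rank := by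
  rw [hP.rank_eq_card_non_zero_eigs, hP.trace_eq_sum_eigenvalues, Fintype.card_subtype,
    Finset.card_filter]
  push_cast
  refine Finset.sum_congr rfl fun i _ => ?_
  rcases hP.eigenvalues_eq_zero_or_one hidem i with h | h <;> simp [h]

/-- The determinant of the operator acting as `x` on the range of an orthogonal projection `P`
and as `y` on its kernel. -/
lemma Matrix.IsHermitian.det_smul_add_smul_one_sub (hP : P.IsHermitian) (hidem : P * P = P)
    (x y : ℝ) :
    (x • P + y • (1 - P)).det = x ^ P.rank * y ^ (Fintype.card n - P.rank) := by
  have hspec : x • P + y • (1 - P) = Unitary.conjStarAlgAut ℝ _ hP.eigenvectorUnitary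
      (diagonal fun i => if hP.eigenvalues i ≠ 0 then x else y) := by
    have hdiag : (diagonal fun i => if hP.eigenvalues i ≠ 0 then x else y) =
        x • diagonal (RCLike.ofReal (K := ℝ) ∘ hP.eigenvalues) +
          y • (1 - diagonal (RCLike.ofReal (K := ℝ) ∘ hP.eigenvalues)) := by
      rw [← diagonal_one, diagonal_sub, ← diagonal_smul, ← diagonal_smul, diagonal_add]
      congr 1
      funext i
      rcases hP.eigenvalues_eq_zero_or_one hidem i with h | h <;> simp [h]
    rw [hdiag, map_add, map_smul, map_smul, map_sub, map_one, ← hP.spectral_theorem]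
  have hcard := hP.rank_eq_card_non_zero_eigs
  rw [Fintype.card_subtype] at hcard
  rw [hspec, Unitary.conjStarAlgAut_apply, det_mul_right_comm,
    ← Unitary.coe_star, Unitary.coe_mul_star_self, one_mul, det_diagonal, Finset.prod_ite, Finset.prod_const,
    Finset.prod_const, ← hcard]
  congr 2
  rw [hcard, ← Finset.card_compl, Finset.compl_filter]

end ProjectionSpectrum

section QuadraticForm

variable {n : Type*} [Fintype n]

lemma sq_dotProduct_le (x y : n → ℝ) : (x ⬝ᵥ y) ^ 2 ≤ (x ⬝ᵥ x) * (y ⬝ᵥ y) := by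
  simpa [dotProduct, sq] using Finset.sum_mul_sq_le_sq_mul_sq Finset.univ x y

/-- The triangle inequality for the seminorm of a positive semidefinite matrix. -/
lemma Matrix.PosSemidef.sqrt_dotProduct_mulVec_add_le {M : Matrix n n ℝ} (hM : M.PosSemidef)
    (x y : n → ℝ) :
    √((x + y) ⬝ᵥ (M *ᵥ (x + y))) ≤ √(x ⬝ᵥ (M *ᵥ x)) + √(y ⬝ᵥ (M *ᵥ y)) := by
  have hnn (z : n → ℝ) : 0 ≤ z ⬝ᵥ (M *ᵥ z) := by simpa using hM.dotProduct_mulVec_nonneg z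
  have hsymm : y ⬝ᵥ (M *ᵥ x) = x ⬝ᵥ (M *ᵥ y) := by
    rw [dotProduct_mulVec, ← mulVec_transpose, dotProduct_comm]
    congr 2
    simpa using hM.1.eq
  have hcs : (x ⬝ᵥ (M *ᵥ y)) ^ 2 ≤ (x ⬝ᵥ (M *ᵥ x)) * (y ⬝ᵥ (M *ᵥ y)) := by
    have h := discrim_le_zero (a := y ⬝ᵥ (M *ᵥ y)) (b := 2 * (x ⬝ᵥ (M *ᵥ y)))
      (c := x ⬝ᵥ (M *ᵥ x)) fun t => by
        have := hnn (x + t • y)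
        simp only [mulVec_add, mulVec_smul, dotProduct_add, add_dotProduct, smul_dotProduct,
          dotProduct_smul, smul_eq_mul, hsymm] at this
        linarith
    unfold discrim at h
    linarith
  have hle : x ⬝ᵥ (M *ᵥ y) ≤ √(x ⬝ᵥ (M *ᵥ x)) * √(y ⬝ᵥ (M *ᵥ y)) := by
    rw [← Real.sqrt_mul (hnn x)]
    exact Real.le_sqrt_of_sq_le hcs
  refine Real.sqrt_le_iff.2 ⟨by positivity, ?_⟩
  rw [add_sq, Real.sq_sqrt (hnn x), Real.sq_sqrt (hnn y)]
  simp only [mulVec_add, dotProduct_add, add_dotProduct, hsymm]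
  linarith

/-- If `B ≥ c` for some `c > 0`, then `B⁻¹ ≤ c⁻¹`, as quadratic forms. -/
lemma dotProduct_inv_mulVec_le [DecidableEq n] {B : Matrix n n ℝ} (hB : IsUnit B.det) {c : ℝ}
    (hc : 0 < c) (hBc : ∀ z, c * (z ⬝ᵥ z) ≤ z ⬝ᵥ (B *ᵥ z)) (x : n → ℝ) :
    x ⬝ᵥ (B⁻¹ *ᵥ x) ≤ (x ⬝ᵥ x) / c := by
  have hx : B *ᵥ (B⁻¹ *ᵥ x) = x := by rw [mulVec_mulVec, mul_nonsing_inv _ hB, one_mulVec]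
  generalize B⁻¹ *ᵥ x = z at hx
  have h1 := hBc z
  rw [hx, dotProduct_comm z x] at h1
  rw [le_div_iff₀ hc]
  have h2 := sq_dotProduct_le x z
  have h3 : 0 ≤ x ⬝ᵥ x := dotProduct_self_star_nonneg x
  by_contra! hlt
  have hpos : 0 < x ⬝ᵥ z := pos_of_mul_pos_left (h3.trans_lt hlt) hc.le
  nlinarith [mul_le_mul_of_nonneg_left h1 h3, mul_lt_mul_of_pos_right hlt hpos]

/-- A positive semidefinite matrix satisfies `det M ≤ exp (tr M - n)`. -/
lemma Matrix.PosSemidef.det_le_exp_trace_sub_card [DecidableEq n] {M : Matrix n n ℝ}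
    (hM : M.PosSemidef) : M.det ≤ Real.exp (M.trace - Fintype.card n) := by
  have hsum : M.trace - Fintype.card n = ∑ i, (hM.1.eigenvalues i - 1) := by
    simp [hM.1.trace_eq_sum_eigenvalues]
  rw [hsum, Real.exp_sum, hM.1.det_eq_prod_eigenvalues]
  refine Finset.prod_le_prod (fun i _ => by simpa using hM.eigenvalues_nonneg i) fun i _ => ?_
  simpa using Real.add_one_le_exp (hM.1.eigenvalues i - 1)

end QuadraticForm

section DeterminantBound

variable {n : Type*} [Fintype n] {P : Matrix n n ℝ}

lemma one_sub_mul_one_sub_of_idem [DecidableEq n] (hidem : P * P = P) : (1 - P) * (1 - P) = 1 - P := by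
  simp [mul_sub, sub_mul, hidem]

/-- The trace of a positive semidefinite matrix compressed by a projection is nonnegative. -/
lemma trace_projection_mul_nonneg (hP : P.IsHermitian) (hidem : P * P = P) {M : Matrix n n ℝ}
    (hM : M.PosSemidef) : 0 ≤ (P * M).trace := by
  have h := (hM.conjTranspose_mul_mul_same P).trace_nonneg
  rwa [hP.eq, trace_mul_comm, ← mul_assoc, hidem] at h

variable [DecidableEq n]

/-- Linearization of `log det` at `a • P + b • (1 - P)`. -/
lemma Matrix.PosSemidef.det_le_of_projection {M : Matrix n n ℝ} (hM : M.PosSemidef)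
    (hP : P.IsHermitian) (hidem : P * P = P) {a b : ℝ} (ha : 0 < a) (hb : 0 < b)
    (htr : (P * M).trace / a + ((1 - P) * M).trace / b ≤ Fintype.card n) :
    M.det ≤ a ^ P.rank * b ^ (Fintype.card n - P.rank) := by
  set R : Matrix n n ℝ := (√a)⁻¹ • P + (√b)⁻¹ • (1 - P) with hR
  have hRherm : Rᴴ = R := by
    have hT : Pᵀ = P := by simpa using hP.eq
    simp [hR, hT]
  have ha' : (√a)⁻¹ * (√a)⁻¹ = a⁻¹ := by rw [← mul_inv, Real.mul_self_sqrt ha.le]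
  have hb' : (√b)⁻¹ * (√b)⁻¹ = b⁻¹ := by rw [← mul_inv, Real.mul_self_sqrt hb.le]
  have hRR : R * R = a⁻¹ • P + b⁻¹ • (1 - P) := by
    have h1 : P * (1 - P) = 0 := by rw [mul_sub, mul_one, hidem, sub_self]
    have h2 : (1 - P) * P = 0 := by rw [sub_mul, one_mul, hidem, sub_self]
    simp only [hR, add_mul, mul_add, smul_mul_smul_comm, hidem, one_sub_mul_one_sub_of_idem hidem,
      h1, h2, ha', hb', smul_zero, add_zero, zero_add]
  have hdet : (Rᴴ * M * R).det = (R * R).det * M.det := by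
    rw [hRherm, det_mul, det_mul, det_mul]
    ring
  have htrace : (Rᴴ * M * R).trace = (P * M).trace / a + ((1 - P) * M).trace / b := by
    rw [hRherm, trace_mul_comm, ← mul_assoc, hRR, add_mul, trace_add, smul_mul_assoc,
      smul_mul_assoc, trace_smul, trace_smul, smul_eq_mul, smul_eq_mul]
    ring
  have hle := (hM.conjTranspose_mul_mul_same R).det_le_exp_trace_sub_card
  rw [hdet, htrace, hRR, hP.det_smul_add_smul_one_sub hidem] at hle
  have hle_one := hle.trans (Real.exp_le_one_iff.2 (sub_nonpos.2 htr))
  rwa [inv_pow, inv_pow, ← mul_inv, inv_mul_le_iff₀ (by positivity), mul_one] at hle_one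

/-- Determinant bound for a Gram matrix regularized by `l1` on the kernel and `l2` on the range of
an orthogonal projection. -/
lemma det_gram_add_le (hP : P.IsHermitian) (hidem : P * P = P) {G : Matrix n n ℝ}
    (hG : G.PosSemidef) {t l1 l2 : ℝ} (ht : G.trace ≤ t) (h1 : 0 < l1) (h2 : 0 < l2)
    (hp : 0 < P.rank) (hq : 0 < Fintype.card n - P.rank)
    (hM : (G + l1 • (1 - P) + l2 • P).PosSemidef) :
    (G + l1 • (1 - P) + l2 • P).det ≤ (l2 + t / P.rank) ^ P.rank *
      (l1 + t / (Fintype.card n - P.rank : ℕ)) ^ (Fintype.card n - P.rank) := by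
  have hQ : (1 - P).IsHermitian := isHermitian_one.sub hP
  have hQidem := one_sub_mul_one_sub_of_idem hidem
  have ht1 := trace_projection_mul_nonneg hP hidem hG
  have ht2 := trace_projection_mul_nonneg hQ hQidem hG
  have hsum : (P * G).trace + ((1 - P) * G).trace = G.trace := by
    rw [← trace_add, ← add_mul, add_sub_cancel, one_mul]
  have ht0 : 0 ≤ t := by linarith
  have hp' : (0 : ℝ) < P.rank := by exact_mod_cast hp
  have hq' : (0 : ℝ) < (Fintype.card n - P.rank : ℕ) := by exact_mod_cast hq
  have hcard : (Fintype.card n : ℝ) = P.rank + (Fintype.card n - P.rank : ℕ) := by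
    norm_cast
    omega
  have hQtr : (1 - P).trace = (Fintype.card n - P.rank : ℕ) := by
    rw [trace_sub, trace_one, hP.trace_eq_rank_of_idem hidem, hcard]
    ring
  have hPtr := hP.trace_eq_rank_of_idem hidem
  have hPQ : P * (1 - P) = 0 := by rw [mul_sub, mul_one, hidem, sub_self]
  have hQP : (1 - P) * P = 0 := by rw [sub_mul, one_mul, hidem, sub_self]
  refine hM.det_le_of_projection hP hidem (by positivity) (by positivity) ?_
  rw [hcard]
  have e1 : (P * (G + l1 • (1 - P) + l2 • P)).trace = (P * G).trace + l2 * P.rank := by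
    simp only [mul_add, mul_smul_comm, hPQ, hidem, smul_zero, add_zero, trace_add, trace_smul,
      hPtr, smul_eq_mul]
  have e2 : ((1 - P) * (G + l1 • (1 - P) + l2 • P)).trace =
      ((1 - P) * G).trace + l1 * (Fintype.card n - P.rank : ℕ) := by
    simp only [mul_add, mul_smul_comm, hQP, hQidem, smul_zero, add_zero, trace_add, trace_smul,
      hQtr, smul_eq_mul]
  rw [e1, e2]
  refine add_le_add ?_ ?_
  · rw [div_le_iff₀ (by positivity), mul_add, mul_div_cancel₀ _ hp'.ne']
    linarith
  · rw [div_le_iff₀ (by positivity), mul_add, mul_div_cancel₀ _ hq'.ne']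
    linarith

end DeterminantBound

/-- Lemma 3 (confidence set bound), conditional on the self-normalized noise event:
‖θ̂ − θ*‖_B ≤ √(S_k + log(1/δ²)) + √λ₂·V + (λ₁/√λ₂)·W. -/
theorem confidence_set_bound (d p k : ℕ) (hp1 : 1 ≤ p) (hpd : p ≤ d - 1)
    (P : Matrix (Fin d) (Fin d) ℝ) (hsymm : Pᵀ = P) (hidem : P * P = P)
    (hrank : P.rank = p)
    (l1 l2 : ℝ) (hl2 : 0 < l2) (hl12 : l2 ≤ l1)
    (δ : ℝ) (hδ0 : 0 < δ) (hδ1 : δ < 1)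
    (V : ℝ) (hV0 : 0 < V)
    (D : Matrix (Fin k) (Fin d) ℝ)
    (hrow : ∀ i : Fin k, Real.sqrt (D i ⬝ᵥ D i) ≤ 1)
    (θstar θbar : Fin d → ℝ) (hθV : Real.sqrt (θstar ⬝ᵥ θstar) ≤ V)
    (ε : Fin k → ℝ) (y : Fin k → ℝ) (hy : y = D *ᵥ θstar + ε)
    (B : Matrix (Fin d) (Fin d) ℝ)
    (hB : B = Dᵀ * D + l1 • ((1 : Matrix (Fin d) (Fin d) ℝ) - P) + l2 • P)
    (θhat : Fin d → ℝ)
    (hθhat : θhat = B⁻¹ *ᵥ (Dᵀ *ᵥ y + l1 • (((1 : Matrix (Fin d) (Fin d) ℝ) - P) *ᵥ θbar)))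
    (W : ℝ)
    (hW : W = Real.sqrt ((((1 : Matrix (Fin d) (Fin d) ℝ) - P) *ᵥ (θstar - θbar)) ⬝ᵥ
        (((1 : Matrix (Fin d) (Fin d) ℝ) - P) *ᵥ (θstar - θbar))))
    (hnoise : (Dᵀ *ᵥ ε) ⬝ᵥ (B⁻¹ *ᵥ (Dᵀ *ᵥ ε))
        ≤ Real.log (B.det / (δ ^ 2 * l1 ^ (d - p) * l2 ^ p))) :
    Real.sqrt ((θhat - θstar) ⬝ᵥ (B *ᵥ (θhat - θstar)))
      ≤ Real.sqrt ((p : ℝ) * Real.log (1 + (k : ℝ) / ((p : ℝ) * l2))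
            + ((d - p : ℕ) : ℝ) * Real.log (1 + (k : ℝ) / (((d - p : ℕ) : ℝ) * l1))
            + Real.log (1 / δ ^ 2))
        + Real.sqrt l2 * V + l1 / Real.sqrt l2 * W := by
  have hP : P.IsHermitian := by simpa [IsHermitian] using hsymm
  have hQ : (1 - P).IsHermitian := isHermitian_one.sub hP
  have hQidem := one_sub_mul_one_sub_of_idem hidem
  have hl1 : 0 < l1 := hl2.trans_le hl12
  have hproj {Q : Matrix (Fin d) (Fin d) ℝ} (h : Q.IsHermitian) (h' : Q * Q = Q)
      (z : Fin d → ℝ) : (Q *ᵥ z) ⬝ᵥ (Q *ᵥ z) = z ⬝ᵥ (Q *ᵥ z) := by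
    have hT : Qᵀ = Q := by simpa using h.eq
    rw [dotProduct_mulVec, ← mulVec_transpose, mulVec_mulVec, hT, h', dotProduct_comm]
  have hself (z : Fin d → ℝ) : z ⬝ᵥ z = (P *ᵥ z) ⬝ᵥ (P *ᵥ z) +
      ((1 - P) *ᵥ z) ⬝ᵥ ((1 - P) *ᵥ z) := by
    rw [hproj hP hidem, hproj hQ hQidem, ← dotProduct_add, ← add_mulVec, add_sub_cancel,
      one_mulVec]
  have hnn {m : ℕ} (z : Fin m → ℝ) : 0 ≤ z ⬝ᵥ z := dotProduct_self_star_nonneg z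
  have hG : (Dᵀ * D).PosSemidef := by simpa using posSemidef_conjTranspose_mul_self D
  have hBherm : B.IsHermitian := by
    rw [hB]
    exact (hG.1.add (hQ.smul (IsSelfAdjoint.all l1))).add (hP.smul (IsSelfAdjoint.all l2))
  have hBlow (z : Fin d → ℝ) : l2 * (z ⬝ᵥ z) ≤ z ⬝ᵥ (B *ᵥ z) := by
    have h := hG.dotProduct_mulVec_nonneg z
    rw [star_trivial] at h
    rw [hself z, hB]
    simp only [add_mulVec, smul_mulVec, dotProduct_add, dotProduct_smul, smul_eq_mul,
      ← hproj hP hidem, ← hproj hQ hQidem]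
    nlinarith [mul_le_mul_of_nonneg_right hl12 (hnn ((1 - P) *ᵥ z))]
  have hBpos : B.PosDef := by
    refine .of_dotProduct_mulVec_pos hBherm fun z hz => ?_
    rw [star_trivial]
    have : 0 < z ⬝ᵥ z := (hnn z).lt_of_ne' (by simpa using hz)
    exact (mul_pos hl2 this).trans_le (hBlow z)
  have hunit : IsUnit B.det := hBpos.det_pos.ne'.isUnit
  have hinv : B⁻¹.PosSemidef := hBpos.inv.posSemidef
  set u := Dᵀ *ᵥ ε with hu
  set v := -(l2 • (P *ᵥ θstar)) with hv
  set w := -(l1 • ((1 - P) *ᵥ (θstar - θbar))) with hw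
  have hBerr : B *ᵥ (θhat - θstar) = u + v + w := by
    rw [mulVec_sub, hθhat, mulVec_mulVec, mul_nonsing_inv _ hunit, one_mulVec, hy, hB, hu, hv, hw]
    simp only [add_mulVec, sub_mulVec, mulVec_add, mulVec_sub, smul_mulVec, mulVec_mulVec,
      one_mulVec, smul_sub]
    abel
  have herr : θhat - θstar = B⁻¹ *ᵥ (u + v + w) := by
    rw [← hBerr, mulVec_mulVec, nonsing_inv_mul _ hunit, one_mulVec]
  rw [hBerr, dotProduct_comm, herr]
  have htri := (hinv.sqrt_dotProduct_mulVec_add_le (u + v) w).trans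
    (add_le_add_left (hinv.sqrt_dotProduct_mulVec_add_le u v) _)
  refine htri.trans (add_le_add (add_le_add (Real.sqrt_le_sqrt (hnoise.trans ?_)) ?_) ?_)
  · have hGtr : (Dᵀ * D).trace ≤ (k : ℝ) := by
      rw [trace_mul_comm]
      calc (D * Dᵀ).trace = ∑ i, D i ⬝ᵥ D i := rfl
        _ ≤ ∑ _i : Fin k, (1 : ℝ) :=
            Finset.sum_le_sum fun i _ => by simpa using hrow i
        _ = k := by simp
    have hdet := det_gram_add_le hP hidem hG hGtr hl1 hl2 (by omega)
      (by rw [Fintype.card_fin]; omega) (hB ▸ hBpos.posSemidef)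
    rw [← hB, hrank, Fintype.card_fin] at hdet
    have hp0 : (0 : ℝ) < p := by exact_mod_cast hp1
    have hq0 : (0 : ℝ) < (d - p : ℕ) := by
      have : 0 < d - p := by omega
      exact_mod_cast this
    have hx : 0 < 1 + (k : ℝ) / (p * l2) := by positivity
    have hz : 0 < 1 + (k : ℝ) / ((d - p : ℕ) * l1) := by positivity
    have hx' : l2 + (k : ℝ) / p = l2 * (1 + k / (p * l2)) := by field_simp
    have hz' : l1 + (k : ℝ) / (d - p : ℕ) = l1 * (1 + k / ((d - p : ℕ) * l1)) := by field_simp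
    rw [hx', hz', mul_pow, mul_pow] at hdet
    rw [← Real.log_pow, ← Real.log_pow, ← Real.log_mul (by positivity) (by positivity),
      ← Real.log_mul (by positivity) (by positivity)]
    refine Real.log_le_log (div_pos hBpos.det_pos (by positivity)) ?_
    rw [div_le_iff₀ (by positivity)]
    refine hdet.trans_eq ?_
    field_simp
  · have h := dotProduct_inv_mulVec_le hunit hl2 hBlow v
    have hPθ : (P *ᵥ θstar) ⬝ᵥ (P *ᵥ θstar) ≤ V ^ 2 :=
      (by linarith [hself θstar, hnn ((1 - P) *ᵥ θstar)] :
        (P *ᵥ θstar) ⬝ᵥ (P *ᵥ θstar) ≤ θstar ⬝ᵥ θstar).trans ((Real.sqrt_le_left hV0.le).1 hθV)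
    refine Real.sqrt_le_iff.2 ⟨by positivity, h.trans ?_⟩
    rw [mul_pow, Real.sq_sqrt hl2.le, div_le_iff₀ hl2, hv]
    simp only [neg_dotProduct, dotProduct_neg, smul_dotProduct, dotProduct_smul, smul_eq_mul]
    nlinarith [mul_le_mul_of_nonneg_left hPθ (mul_pos hl2 hl2).le]
  · have h := dotProduct_inv_mulVec_le hunit hl2 hBlow w
    have hW0 : 0 ≤ W := hW ▸ Real.sqrt_nonneg _
    refine Real.sqrt_le_iff.2 ⟨by positivity, h.trans_eq ?_⟩
    rw [mul_pow, div_pow, Real.sq_sqrt hl2.le, hW, Real.sq_sqrt (hnn _), hw]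
    simp only [neg_dotProduct, dotProduct_neg, smul_dotProduct, dotProduct_smul, smul_eq_mul]
    ring
end

section
/- Let A be a finite nonempty set of arms with context vectors x_a ∈ ℝ^d, B a d×d symmetric positive definite matrix, θ*, θ̂, θ̃ ∈ ℝ^d, and l, g ≥ 0. Suppose that for every a ∈ A: |x_aᵀ(θ̂ − θ*)| ≤ l·‖x_a‖_{B⁻¹} and |x_aᵀ(θ̂ − θ̃)| ≤ g·‖x_a‖_{B⁻¹}. If â maximizes x_aᵀθ̃ over A and a* maximizes x_aᵀθ* over A, then x_{a*}ᵀθ* − x_{â}ᵀθ* ≤ (l + g)·( ‖x_{a*}‖_{B⁻¹} + ‖x_{â}‖_{B⁻¹} ). -/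
open Matrix

/-- Thompson-sampling instantaneous regret bound: under events E_r and E_θ, the arm
maximizing the sampled index satisfies
x_{a*}ᵀθ* − x_{â}ᵀθ* ≤ (l + g)(‖x_{a*}‖_{B⁻¹} + ‖x_{â}‖_{B⁻¹}). -/
theorem ts_instantaneous_regret {ι : Type*} (d : ℕ)
    (A : Finset ι) (hA : A.Nonempty)
    (x : ι → Fin d → ℝ)
    (B : Matrix (Fin d) (Fin d) ℝ) (hB : B.PosDef)
    (θstar θhat θtilde : Fin d → ℝ) (l g : ℝ) (hl : 0 ≤ l) (hg : 0 ≤ g)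
    (hEr : ∀ a ∈ A, |x a ⬝ᵥ (θhat - θstar)| ≤ l * Real.sqrt (x a ⬝ᵥ (B⁻¹ *ᵥ x a)))
    (hEθ : ∀ a ∈ A, |x a ⬝ᵥ (θhat - θtilde)| ≤ g * Real.sqrt (x a ⬝ᵥ (B⁻¹ *ᵥ x a)))
    (ahat astar : ι) (hahat : ahat ∈ A) (hastar : astar ∈ A)
    (hmax : ∀ a ∈ A, x a ⬝ᵥ θtilde ≤ x ahat ⬝ᵥ θtilde)
    (hopt : ∀ a ∈ A, x a ⬝ᵥ θstar ≤ x astar ⬝ᵥ θstar) :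
    x astar ⬝ᵥ θstar - x ahat ⬝ᵥ θstar
      ≤ (l + g) * (Real.sqrt (x astar ⬝ᵥ (B⁻¹ *ᵥ x astar))
        + Real.sqrt (x ahat ⬝ᵥ (B⁻¹ *ᵥ x ahat))) := by
  simp only [dotProduct_sub, abs_le] at hEr hEθ
  linarith [(hEr astar hastar).1, (hEr ahat hahat).2, (hEθ astar hastar).2, (hEθ ahat hahat).1,
    hmax astar hastar]
end
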